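/- Let M be the 4×4 matrix with rows (1, 0, 0, 0), (1.6872, 1.5909, 2.7170, 7.8740), (−1.0519, 3.4185, 14.1275, 6.8633), (2.7208, 1.3832, 4.2118, 6.8602), where the decimal entries are taken as exact rational numbers. Then the set S(M) = {(t₁, t₂, s₁, s₂) ∈ ℂ⁴ : F(t₁, t₂, s₁, s₂; M) = 0, t₁ ≠ t₂, s₁ ≠ s₂} has exactly 40 elements, and no element (t₁, t₂, s₁, s₂) of S(M) satisfies {t₁, t₂} = {conj(t₁), conj(t₂)}; i.e., none of the ten common secant lines of the standard twisted cubic and its image under M is real. -/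

import Mathlib

open Matrix

noncomputable section

/-- `v(a) = (1, a, a², a³) ∈ ℂ⁴`. -/
def tcv (a : ℂ) : Fin 4 → ℂ := ![1, a, a ^ 2, a ^ 3]

/-- `pᵢ(s; M)`, the `i`-th coordinate of `M·v(s)`. -/
def pc (M : Matrix (Fin 4) (Fin 4) ℂ) (i : Fin 4) (s : ℂ) : ℂ := M.mulVec (tcv s) i

/-- `f₁(t₁, t₂, s; M) = p₃(s; M) − (t₁ + t₂)p₂(s; M) + t₁t₂p₁(s; M)`. -/
def f₁ (M : Matrix (Fin 4) (Fin 4) ℂ) (t₁ t₂ s : ℂ) : ℂ :=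
  pc M 2 s - (t₁ + t₂) * pc M 1 s + t₁ * t₂ * pc M 0 s

/-- `f₂(t₁, t₂, s; M) = p₄(s; M) − (t₁ + t₂)p₃(s; M) + t₁t₂p₂(s; M)`. -/
def f₂ (M : Matrix (Fin 4) (Fin 4) ℂ) (t₁ t₂ s : ℂ) : ℂ :=
  pc M 3 s - (t₁ + t₂) * pc M 2 s + t₁ * t₂ * pc M 1 s

/-- The square polynomial system `F(·; M)` viewed as a map `ℂ⁴ → ℂ⁴`, with the
variables ordered `(t₁, t₂, s₁, s₂)`. -/
def Fmap (M : Matrix (Fin 4) (Fin 4) ℂ) (x : Fin 4 → ℂ) : Fin 4 → ℂ :=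
  ![f₁ M (x 0) (x 1) (x 2), f₁ M (x 0) (x 1) (x 3),
    f₂ M (x 0) (x 1) (x 2), f₂ M (x 0) (x 1) (x 3)]

/-- `S(M)`: solutions of `F(·; M) = 0` with `t₁ ≠ t₂` and `s₁ ≠ s₂`. -/
def Ssol (M : Matrix (Fin 4) (Fin 4) ℂ) : Set (Fin 4 → ℂ) :=
  {x | Fmap M x = 0 ∧ x 0 ≠ x 1 ∧ x 2 ≠ x 3}

/-- The 4×4 Jacobian matrix of `F(·; M)` with respect to `(t₁, t₂, s₁, s₂)`. -/
def Jac (M : Matrix (Fin 4) (Fin 4) ℂ) (x : Fin 4 → ℂ) : Matrix (Fin 4) (Fin 4) ℂ :=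
  fun i j => deriv (fun z => Fmap M (Function.update x j z) i) (x j)

/-- A real matrix viewed as a complex matrix. -/
def cm (M : Matrix (Fin 4) (Fin 4) ℝ) : Matrix (Fin 4) (Fin 4) ℂ :=
  M.map Complex.ofReal

/-- The matrix of the "0 totally real lines" example, with the decimal entries taken as
exact rationals. -/
def M₁₇ : Matrix (Fin 4) (Fin 4) ℚ :=
  !![1, 0, 0, 0;
     1.6872, 1.5909, 2.7170, 7.8740;
     -1.0519, 3.4185, 14.1275, 6.8633;
     2.7208, 1.3832, 4.2118, 6.8602]

/-! ### Integer polynomials as coefficient lists -/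

/-- The value at `x` of the polynomial with coefficient list `l`, constant coefficient first. -/
def hornerEval {R : Type*} [CommRing R] : List ℤ → R → R
  | [], _ => 0
  | a :: l, x => a + x * hornerEval l x

/-- Sum of coefficient lists. -/
def coeffAdd : List ℤ → List ℤ → List ℤ
  | [], q => q
  | p, [] => p
  | a :: p, b :: q => (a + b) :: coeffAdd p q

/-- Integer multiple of a coefficient list. -/
def coeffSmul (c : ℤ) : List ℤ → List ℤ
  | [] => []
  | a :: p => (c * a) :: coeffSmul c p

/-- Product of coefficient lists. -/
def coeffMul : List ℤ → List ℤ → List ℤ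
  | [], _ => []
  | a :: p, q => coeffAdd (coeffSmul a q) (0 :: coeffMul p q)

/-- Coefficient list of the derivative. -/
def coeffDeriv : List ℤ → List ℤ
  | [] => []
  | [_] => []
  | _ :: a :: l => coeffAdd (a :: l) (0 :: coeffDeriv (a :: l))

/-- Greatest common divisor of the coefficients. -/
def coeffContent : List ℤ → ℕ
  | [] => 0
  | a :: l => Nat.gcd a.natAbs (coeffContent l)

/-- Division of all the coefficients by an integer. -/
def coeffDiv (c : ℤ) : List ℤ → List ℤ
  | [] => []
  | a :: p => (a / c) :: coeffDiv c p

/-- Division of all the coefficients by their greatest common divisor. -/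
def coeffPrimPart (l : List ℤ) : List ℤ :=
  coeffDiv (coeffContent l) l

/-- Cancellation of the constant coefficients of `p` and `q`, followed by division by `X`. -/
def coeffElim : List ℤ → List ℤ → List ℤ
  | a :: p, b :: q => coeffPrimPart (coeffAdd (coeffSmul b p) (coeffSmul (-a) q))
  | _, _ => []

/-- Whether iterated elimination of the constant coefficient by means of `p` reduces `q` to `0`. -/
def vanishesModulo (p : List ℤ) : ℕ → List ℤ → Bool
  | 0, _ => false
  | n + 1, q => q.all (fun a => a == 0) || vanishesModulo p n (coeffElim q p)

/-- A Euclidean algorithm (from the constant coefficient upwards) which succeeds when `p` and `q`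
are coprime. -/
def coprimeTest : ℕ → List ℤ → List ℤ → Bool
  | 0, _, _ => false
  | _ + 1, _, [c] => c != 0
  | n + 1, p, q =>
    let r := coeffElim p q
    if q.length.ble r.length then coprimeTest n r q else coprimeTest n q r

/-- Coefficient lists of `∑ k, l k * (a + b * t) ^ k * (c + e * t) ^ (l.length - 1 - k)` and of
`(c + e * t) ^ l.length`. -/
def coeffMobius (a b c e : ℤ) : List ℤ → List ℤ × List ℤ
  | [] => ([], [1])
  | k :: l =>
    let r := coeffMobius a b c e l
    (coeffAdd (coeffSmul k r.2) (coeffMul [a, b] r.1), coeffMul [c, e] r.2)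

/-- Whether the coefficients are nonnegative and the constant one is positive. -/
def coeffPositive : List ℤ → Bool
  | [] => false
  | a :: l => decide (0 < a) && l.all (fun k => decide (0 ≤ k))

section HornerEval

variable {R : Type*} [CommRing R]

theorem hornerEval_coeffAdd (p q : List ℤ) (x : R) :
    hornerEval (coeffAdd p q) x = hornerEval p x + hornerEval q x := by
  induction p generalizing q with
  | nil => simp [coeffAdd, hornerEval]
  | cons a p ih =>
    cases q with
    | nil => simp [coeffAdd, hornerEval]
    | cons b q => simp only [coeffAdd, hornerEval, ih]; push_cast; ring

theorem hornerEval_coeffSmul (c : ℤ) (p : List ℤ) (x : R) :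
    hornerEval (coeffSmul c p) x = c * hornerEval p x := by
  induction p with
  | nil => simp [coeffSmul, hornerEval]
  | cons a p ih => simp only [coeffSmul, hornerEval, ih]; push_cast; ring

theorem hornerEval_coeffMul (p q : List ℤ) (x : R) :
    hornerEval (coeffMul p q) x = hornerEval p x * hornerEval q x := by
  induction p with
  | nil => simp [coeffMul, hornerEval]
  | cons a p ih =>
    simp only [coeffMul, hornerEval, hornerEval_coeffAdd, hornerEval_coeffSmul, ih]
    push_cast
    ring

theorem map_hornerEval {S : Type*} [CommRing S] (f : R →+* S) (l : List ℤ) (x : R) :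
    f (hornerEval l x) = hornerEval l (f x) := by
  induction l with
  | nil => simp [hornerEval]
  | cons a l ih => simp [hornerEval, ih]

theorem hornerEval_coeffDiv (c : ℤ) (l : List ℤ) (h : ∀ a ∈ l, c ∣ a) (x : R) :
    c * hornerEval (coeffDiv c l) x = hornerEval l x := by
  induction l with
  | nil => simp [coeffDiv, hornerEval]
  | cons a l ih =>
    have h1 : (c : R) * ((a / c : ℤ) : R) = a := by
      rw [← Int.cast_mul, Int.mul_ediv_cancel' (h a (by simp))]
    have h2 := ih (fun b hb => h b (by simp [hb]))
    simp only [coeffDiv, hornerEval]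
    linear_combination h1 + x * h2

theorem coeffContent_dvd (l : List ℤ) : ∀ a ∈ l, (coeffContent l : ℤ) ∣ a := by
  induction l with
  | nil => simp
  | cons b l ih =>
    intro a ha
    rw [coeffContent, Int.natCast_dvd]
    rcases List.mem_cons.mp ha with rfl | ha
    · exact Nat.gcd_dvd_left _ _
    · exact (Nat.gcd_dvd_right _ _).trans (Int.natCast_dvd.mp (ih a ha))

theorem hornerEval_eq_zero_of_all (l : List ℤ) (h : l.all (fun a => a == 0) = true) (x : R) :
    hornerEval l x = 0 := by
  induction l with
  | nil => rfl
  | cons a l ih =>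
    simp only [List.all_cons, Bool.and_eq_true, beq_iff_eq] at h
    simp [hornerEval, h.1, ih h.2]

theorem coeffDiv_zero_all (l : List ℤ) : (coeffDiv 0 l).all (fun a => a == 0) = true := by
  induction l with
  | nil => rfl
  | cons a l ih => simpa [coeffDiv] using ih

theorem hornerEval_coeffPrimPart_eq_zero [IsDomain R] [CharZero R] (l : List ℤ) (x : R) :
    hornerEval (coeffPrimPart l) x = 0 ↔ hornerEval l x = 0 := by
  have h := hornerEval_coeffDiv (coeffContent l) l (coeffContent_dvd l) x
  rw [coeffPrimPart]
  rcases Nat.eq_zero_or_pos (coeffContent l) with h0 | h0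
  · rw [h0] at h ⊢
    have := hornerEval_eq_zero_of_all _ (coeffDiv_zero_all l) x
    simp only [Nat.cast_zero, Int.cast_zero, zero_mul] at h ⊢
    simp [this, ← h]
  · rw [← h]
    simp [h0.ne']

theorem hornerEval_coeffElim_eq_zero [IsDomain R] [CharZero R] {a b : ℤ} {p q : List ℤ} {x : R}
    (hx : x ≠ 0) :
    hornerEval (coeffElim (a :: p) (b :: q)) x = 0 ↔
      b * hornerEval (a :: p) x = a * hornerEval (b :: q) x := by
  rw [coeffElim, hornerEval_coeffPrimPart_eq_zero, hornerEval_coeffAdd, hornerEval_coeffSmul,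
    hornerEval_coeffSmul, ← mul_right_inj' hx, mul_zero, ← sub_eq_zero (a := (b : R) * _)]
  simp only [hornerEval, Int.cast_neg]
  ring_nf

theorem hornerEval_eq_zero_of_vanishesModulo [IsDomain R] [CharZero R] {b : ℤ} {p : List ℤ} {x : R}
    (hb : b ≠ 0) (hx : x ≠ 0) (hp : hornerEval (b :: p) x = 0) (n : ℕ) (q : List ℤ)
    (h : vanishesModulo (b :: p) n q = true) : hornerEval q x = 0 := by
  induction n generalizing q with
  | zero => simp [vanishesModulo] at h
  | succ n ih =>
    rw [vanishesModulo, Bool.or_eq_true] at h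
    rcases h with h | h
    · exact hornerEval_eq_zero_of_all q h x
    · cases q with
      | nil => rfl
      | cons a q =>
        have h1 := (hornerEval_coeffElim_eq_zero hx).mp (ih _ h)
        rw [hp, mul_zero] at h1
        exact (mul_eq_zero.mp h1).resolve_left (Int.cast_ne_zero.mpr hb)

theorem hornerEval_coeffElim_of_eq_zero [IsDomain R] [CharZero R] {p q : List ℤ} {x : R}
    (hx : x ≠ 0) (hp : hornerEval p x = 0) (hq : hornerEval q x = 0) :
    hornerEval (coeffElim p q) x = 0 := by
  rcases p with _ | ⟨a, p⟩
  · rfl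
  · rcases q with _ | ⟨b, q⟩
    · rfl
    · rw [hornerEval_coeffElim_eq_zero hx, hp, hq, mul_zero, mul_zero]

theorem hornerEval_ne_zero_of_coprimeTest [IsDomain R] [CharZero R] {x : R} (hx : x ≠ 0) (n : ℕ)
    (p q : List ℤ) (h : coprimeTest n p q = true) (hp : hornerEval p x = 0) :
    hornerEval q x ≠ 0 := by
  intro hq
  induction n generalizing p q with
  | zero => simp [coprimeTest] at h
  | succ n ih =>
    have he := hornerEval_coeffElim_of_eq_zero hx hp hq
    unfold coprimeTest at h
    split at h
    · contradiction
    · simp [hornerEval] at hq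
      simp [hq] at h
    · rename_i heq _
      cases heq
      dsimp only at h
      split at h
      · exact ih _ _ h he hq
      · exact ih _ _ h hq he

end HornerEval

theorem hornerEval_coeffMobius {a b c e : ℤ} {x t : ℝ} (hx : x * (c + e * t) = a + b * t)
    (l : List ℤ) :
    hornerEval (coeffMobius a b c e l).2 t = (c + e * t) ^ l.length ∧
      (c + e * t) * hornerEval (coeffMobius a b c e l).1 t =
        (c + e * t) ^ l.length * hornerEval l x := by
  induction l with
  | nil => simp [coeffMobius, hornerEval]
  | cons k l ih =>
    obtain ⟨h1, h2⟩ := ih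
    simp only [coeffMobius, hornerEval_coeffAdd, hornerEval_coeffSmul, hornerEval_coeffMul, h1,
      List.length_cons, pow_succ]
    simp only [hornerEval]
    constructor
    · ring
    · linear_combination (a + b * t) * h2 -
        (c + e * t) ^ l.length * hornerEval l x * hx

theorem hornerEval_pos {l : List ℤ} (hl : coeffPositive l = true) {t : ℝ} (ht : 0 ≤ t) :
    0 < hornerEval l t := by
  cases l with
  | nil => simp [coeffPositive] at hl
  | cons a l =>
    simp only [coeffPositive, Bool.and_eq_true, decide_eq_true_eq, List.all_eq_true] at hl
    have h : ∀ m : List ℤ, (∀ k ∈ m, 0 ≤ k) → 0 ≤ hornerEval m t := by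
      intro m hm
      induction m with
      | nil => exact le_rfl
      | cons k m ih =>
        have h1 : (0 : ℝ) ≤ k := by exact_mod_cast hm k (by simp)
        have h2 := ih fun j hj => hm j (by simp [hj])
        simp only [hornerEval]
        positivity
    have h1 : (0 : ℝ) < a := by exact_mod_cast hl.1
    have h2 := h l hl.2
    simp only [hornerEval]
    positivity

/-- A polynomial has no zero on the image of `[0, ∞)` under a Möbius transformation if pulling it
back yields positive coefficients. -/
theorem hornerEval_ne_zero_of_coeffMobius (a b c e : ℤ) (l : List ℤ)
    (hl : coeffPositive (coeffMobius a b c e l).1 = true) {x : ℝ}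
    (h1 : 0 ≤ c * x - a) (h2 : 0 < b - e * x) (h3 : 0 < b * c - a * e) : hornerEval l x ≠ 0 := by
  intro h
  have h4 : (b - e * x : ℝ) ≠ 0 := h2.ne'
  have h5 : (c + e * ((c * x - a) / (b - e * x)) : ℝ) = (b * c - a * e) / (b - e * x) := by
    field_simp
    ring
  have h6 : x * (c + e * ((c * x - a) / (b - e * x)) : ℝ) =
      a + b * ((c * x - a) / (b - e * x)) := by
    rw [h5, ← mul_div_assoc, ← mul_div_assoc, add_comm (a : ℝ), div_add' _ _ _ h4]
    ring
  have h7 := (hornerEval_coeffMobius h6 l).2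
  rw [h, mul_zero, h5] at h7
  have h8 := hornerEval_pos hl (div_nonneg h1 h2.le)
  have h9 : (0 : ℝ) < b * c - a * e := by exact_mod_cast h3
  have := mul_pos (div_pos h9 h2) h8
  exact this.ne' h7

/-- The complex polynomial with coefficient list `l`. -/
def ofCoeffs : List ℤ → Polynomial ℂ
  | [] => 0
  | a :: l => Polynomial.C (a : ℂ) + Polynomial.X * ofCoeffs l

theorem eval_ofCoeffs (l : List ℤ) (x : ℂ) : (ofCoeffs l).eval x = hornerEval l x := by
  induction l with
  | nil => simp [ofCoeffs, hornerEval]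
  | cons a l ih => simp [ofCoeffs, hornerEval, ih]

theorem eval_derivative_ofCoeffs (l : List ℤ) (x : ℂ) :
    (ofCoeffs l).derivative.eval x = hornerEval (coeffDeriv l) x := by
  induction l with
  | nil => simp [ofCoeffs, hornerEval, coeffDeriv]
  | cons a l ih =>
    cases l with
    | nil => simp [ofCoeffs, hornerEval, coeffDeriv]
    | cons b l =>
      rw [coeffDeriv, hornerEval_coeffAdd]
      rw [ofCoeffs]
      simp only [Polynomial.derivative_add, Polynomial.derivative_C, Polynomial.derivative_mul,
        Polynomial.derivative_X, Polynomial.eval_add, Polynomial.eval_zero, Polynomial.eval_mul,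
        Polynomial.eval_one, Polynomial.eval_X, ih, eval_ofCoeffs]
      simp [hornerEval]

theorem coeff_ofCoeffs (l : List ℤ) (n : ℕ) : (ofCoeffs l).coeff n = (l.getD n 0 : ℤ) := by
  induction l generalizing n with
  | nil => simp [ofCoeffs]
  | cons a l ih =>
    cases n with
    | zero => simp [ofCoeffs]
    | succ n =>
      rw [ofCoeffs, Polynomial.coeff_add, Polynomial.coeff_C_succ, Polynomial.coeff_X_mul, ih,
        zero_add, List.getD_cons_succ]

theorem natDegree_ofCoeffs {l : List ℤ} {n : ℕ} (hl : l.length = n + 1) (hn : l.getD n 0 ≠ 0) :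
    (ofCoeffs l).natDegree = n := by
  apply le_antisymm
  · rw [Polynomial.natDegree_le_iff_coeff_eq_zero]
    intro N hN
    rw [coeff_ofCoeffs, List.getD_eq_default _ _ (by omega), Int.cast_zero]
  · apply Polynomial.le_natDegree_of_ne_zero
    rw [coeff_ofCoeffs]
    exact_mod_cast hn

theorem card_roots_ofCoeffs {l : List ℤ} {n : ℕ} (hl : l.length = n + 1) (hn : l.getD n 0 ≠ 0)
    (h : ∀ x : ℂ, hornerEval l x = 0 → hornerEval (coeffDeriv l) x ≠ 0) :
    (ofCoeffs l).roots.toFinset.card = n := by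
  have h0 : ofCoeffs l ≠ 0 := by
    intro h0
    have := coeff_ofCoeffs l n
    rw [h0, Polynomial.coeff_zero] at this
    exact hn (by exact_mod_cast this.symm)
  have hnd : (ofCoeffs l).roots.Nodup := by
    rw [Multiset.nodup_iff_count_le_one]
    intro x
    rw [Polynomial.count_roots]
    by_contra! hlt
    obtain ⟨h1, h2⟩ := (Polynomial.one_lt_rootMultiplicity_iff_isRoot h0).mp hlt
    rw [Polynomial.IsRoot, eval_ofCoeffs] at h1
    rw [Polynomial.IsRoot, eval_derivative_ofCoeffs] at h2
    exact h x h1 h2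
  rw [Multiset.toFinset_card_of_nodup hnd, IsAlgClosed.card_roots_eq_natDegree,
    natDegree_ofCoeffs hl hn]

/-! ### The eliminant of the system and a rational parametrization of its solutions -/

/-- The eliminant of the system in the variable `e₁ = t₁ + t₂`. -/
def eliminant : List ℤ :=
  [353242056708957011343829981856043908887749877191845032290723517817034141063449,
    -134994335438632454637030212043066260573840780564588694314822966499779894301314,
    -337512076660947936124944320148487413985692281316078360335754309539052169584000,
    670254913167769547620821591069148985040347644024782288057793756837253633707000,
    98399937137087988956722324953714437416361262267757626554402828837902435892000,
    -453725826632412627941618331739571335430706876201132543264842429384212008000000,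
    285868459357276834074665247486542466072782495904539225393923424231920395000000,
    191200501155177483440282065678291051709075681297384516621567971668271446000000,
    -129080039600061844330704029540770541422539593077997544627548373713160000000000,
    15499808284781298148399721412654736848159467689921120180000381793865000000000,
    42489591667889758137482447706587747089710530556777003235385819299800000000000]

/-- Numerator of `40 * t₁ * t₂`, over the derivative of the eliminant. -/
def prodNumer : List ℤ :=
  [31907467767883476861704147259923247946403144312699082830670652036919133502900973,
    -132144861361143228447027286211757832096634332998560175405105759372990509380082538,
    -30357000276714217831945661732886212161971243308166723238508307223538470773234960,
    136946721848349325142530850361187671767872968797756956281629820769824588211159000,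
    -118748419121764658811176966109993934947926797786218461819889185368987345819956000,
    -92995446485248135584252617319789711341123707810169017479099219733749072550080000,
    64674462657557503079607903012241155304220697073303672846195392364898822055000000,
    -10336249849808589649427370579212632370812544422275438141721619780847201378000000,
    -30417045873126088619045695026508756889184844362688752687890294471791793520000000,
    -1268202961341339730732223572041923152173522615651182458176649627662195000000000]

/-- Common denominator of `sourceSumNumer` and `sourceProdNumer`. -/
def sourceDenom : ℤ :=
  64334072394164369737872835180808210453364989213121

/-- Numerator of `sourceDenom * (s₁ + s₂)`, over the derivative of the eliminant. -/
def sourceSumNumer : List ℤ :=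
  [82355978958281079406201691494411390273686644920258514227311044096100160864028196666621329430413373636912672974118549339679285146,
    113518783027793190634824338520460359721215694462326629912778964822543843716547267777314182217479523595599106589979180784065076740,
    -106688305369806844701463268386603470449444498443352249712700553948708768144020577255064256612586335934309683904810550407141272800,
    3394387840855595930478071697006091577457384031335707046876503637122242517606791063179573794759864551384630450467944869384254000,
    196162449597163054006192896498457971796696402684881177968108774532837699410194025108367223287336270027211769985826929339019740000,
    -30272155415029990796756395796417126885249836818520016257604647004183219830255047977039901223152748303334798188291350891358800000,
    -62448439320125449519538027693632680197483874106815236250526065195964794831705589389955236889767517572180035406042069041700000000,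
    58010482126545934339131148421112665687865115114070424888675619612873041141013869958759010840653399846021819007819945334000000000,
    15574431398043846324551882874778712842976290367882669477256143815122470195714864265500545157217242297907618192367034670000000000,
    -11194006297876504032277517748853638727697174180401346006949887513676749405477187453414913327665641000424800860713052500000000000]

/-- Numerator of `sourceDenom * s₁ * s₂`, over the derivative of the eliminant. -/
def sourceProdNumer : List ℤ :=
  [-2034730330931381684911076732895326660316592082074068517695325433031413293719200607497194947803899297855459449250319983473066157,
    -9360726838352591462602360215262711578918863302040050695116794248185870571566616423945108362451272138408193723496527460131881220,
    15985873507442948097248880789396161382446708248880521843550134693975995193144341198036976927563705842101870321070419626888479400,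
    5358937927166379489564392594291331171475870831039117070889771822067874237446221142740603976204731305009047287274362715195156000,
    -24132598317536076051958556296479915135099598309088372560208125289815003547479961167647107144500262504899558807940125720046520000,
    7747523055423026582723521002576537893793146742824556991017644901571862814648338353139397450865659706663114181405571632432400000,
    11630633897834523142090514542906833004043263742594981694022186023529592012977103863027845367630737153314143054555535502207000000,
    -8474159011987760767442450544480716251363846916746549874582402422801493219666565840119665139237616949455614144263674471300000000,
    -1495448284798911657403406326205233161962286505304189684824325735709825310051177954778569593233308180338990061262635839000000000,
    2338310667766454378558767890373253523861907071617202992724176610325563851900109582979988205260355513096443671647363690000000000]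

/-- Multipliers expressing the eliminant through the minors of the Bézout matrix. -/
def eliminantCofactor : Fin 5 → List ℤ :=
  ![[-1858581216638856421060814977625772436293555006341277623536020,
     -680684101866331324265745145523276498462173683712320868800000,
     1088410917448720484139056403412263724708594135056642035760000,
     -690962800949497981814186946354069897448138271451468545820000,
     -818714616224168751805781920285900750826500655084841000000000,
     160400155200708577938636449273596378503034259334960000000000,
     113928199934900922594981477215717693146801290000000000000000],
    [1554405851973887456293941305176639008351288639244780626326730,
     1010925474680011677070154148698860715066193861530781381960000,
     -719683282657593537784921053446675489262845528320436983320000,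
     337378128060562116247415244449801766907103718341872830870000,
     818088663698969161172430889623131297580120744086898300000000,
     90278495600660768882241574859572480841049236216232000000000,
     -58939127246940033286231347599463025117072107000000000000000],
    [-690585109746450336648445064500756495938391338100094218322217,
     -405311786537405734275132260702005299856993407369387015060000,
     338648411423748971681529726883348366032189579571922419836000,
     -173750659011479171524124722203101102296463945908666254567000,
     -350225143312246531901612112278651546659715798049141750000000,
     -17841703137285889936401166085149421804115348479460000000000,
     29791109756234418199635314400291733043179147500000000000000],
    [605226216287352781277490614816730128768938388472677579949618,
     523234016037564793516401347404737721851479736892833197316000,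
     -242809888238732185828972115750987096826503675767926686712000,
     82836798843323841341584904165925027343406079616860654792000,
     388538040114034226399453934524907480444320094487952460000000,
     71334822871432168962788743480778073578610124327711200000000,
     -36796427490725421327955977434205037619984163720000000000000],
    [-194169880373478586159262012406677603126834666708964897305296,
     -268826794337984164093380560143176355307763472297735362148000,
     -19595430626167963706946588611295458519656696308634066528000,
     10566103675279999264175326222499789190832020373516007232000,
     -125266309300348593098943837575350846602051861137147280000000,
     -90443207249220559064663152726967232129177522382773600000000,
     -15952302368351388600351718706740015342993005444000000000000]]

/-- Multipliers expressing the equation for `t₁ * t₂` through the minors of the Bézout matrix. -/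
def prodCofactor : Fin 5 → List ℤ :=
  ![[140768002108935020790271342295083450078356458589370025307765540,
     -720311011167337069816653614017071283261108551726298543815408000,
     -229450988640373900041367572580276242298432390224284189206320000,
     449809675937242371554684180420486845486465046883572560984140000,
     -327066278877716193482172709868472738998930177128505216328000000,
     -246164195324949576361880035678968005652562550015979960000000000,
     66238053350751957049167292113176972742499231966992000000000000],
    [-108345381947400933331566104085153678129206777541327510566517010,
     619483154514298799386717224821616309047371358558887102745072000,
     243185905547889977117972606085481806042328901302746075415640000,
     -373776126386123235618901792543524259281462908830150147264590000,
     242793499547452450670259125515398125683731354011624810748000000,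
     228082745554788038455215164487055512095839241428961268000000000,
     -34267310966559136108032477381431065053313780836753600000000000],
    [49066343602826207897434396520257285376154087149982838787665309,
     -273529002903260486390069807114826530139395497163057204502276800,
     -102953155361924821329952233850115866420958482278903805498652000,
     166299612991702879188742781834969104826966287993565345683059000,
     -110917723630178140781160994563810652005214127835274053826800000,
     -99128500715494041711448713563457529547809851047536290000000000,
     17320602963437654556253789233909882808330750704108000000000000],
    [-42838612142446290715637553341880351800890184313249967053660666,
     226613111488379807494723190212984313166899815142240739697495200,
     147854234789748906409257233371653509031522987917694063118824000,
     -111562081113394725991074781861902965292669774054569315811144000,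
     68077450401260750370281599053706821328575667582047480496800000,
     107602026581618947061320982198777839414790428338142210800000000,
     9825404300911165587723823028631218565954769367742240000000000],
    [12692083872643235843142796377177391755858188636448709347759632,
     -72093509304782867715765012286254089249651262655218288764722400,
     -76102214495993121919560337674329513540371048020950585646624000,
     24782745901137127672746276177088986322403789098996613870016000,
     -4727457534594808147253611739076198006740316846656266147200000,
     -43333619678235272608492376663863662292184383589433002400000000,
     -14652966354899171478030493657008617906639434361214720000000000]]

/-- The system satisfied by the symmetric functions `x = t₁ + t₂`, `e = t₁ * t₂`, `u = s₁ + s₂`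
and `v = s₁ * s₂` of a solution: modulo `s ^ 2 - u * s + v` the two cubics vanish. -/
structure IsSecant (x e u v : ℂ) : Prop where
  lin₁ : (34185 - 15909 * x) + (141275 - 27170 * x) * u + (68633 - 78740 * x) * (u ^ 2 - v) = 0
  const₁ : (-10519 - 16872 * x + 10000 * e) - (141275 - 27170 * x) * v
    - (68633 - 78740 * x) * (u * v) = 0
  lin₂ : (13832 - 34185 * x + 15909 * e) + (42118 - 141275 * x + 27170 * e) * u
    + (68602 - 68633 * x + 78740 * e) * (u ^ 2 - v) = 0
  const₂ : (27208 + 10519 * x + 16872 * e) - (42118 - 141275 * x + 27170 * e) * v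
    - (68602 - 68633 * x + 78740 * e) * (u * v) = 0

/-- The derivative of the eliminant. -/
def eliminantDeriv : List ℤ :=
  coeffDeriv eliminant

/-- Numerator of `k + l * x + m * e` over `40 * eliminantDeriv`. -/
def formNumer (k l m : ℤ) : List ℤ :=
  coeffAdd (coeffSmul 40 (coeffMul [k, l] eliminantDeriv)) (coeffSmul m prodNumer)

/-- Numerator of `v` over `sourceDenom ^ 2 * eliminantDeriv ^ 2`. -/
def sourceProdNumerSq : List ℤ :=
  coeffSmul sourceDenom (coeffMul eliminantDeriv sourceProdNumer)

/-- Numerator of `u` over `sourceDenom ^ 2 * eliminantDeriv ^ 2`. -/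
def sourceSumNumerSq : List ℤ :=
  coeffSmul sourceDenom (coeffMul eliminantDeriv sourceSumNumer)

/-- The polynomial `sourceDenom ^ 2 * eliminantDeriv ^ 2`. -/
def sourceDenomSq : List ℤ :=
  coeffSmul (sourceDenom ^ 2) (coeffMul eliminantDeriv eliminantDeriv)

/-- Numerator of `p₁ + p₂ * u + p₃ * (u ^ 2 - v)`. -/
def linNumer (p₁ p₂ p₃ : List ℤ) : List ℤ :=
  coeffAdd (coeffAdd (coeffMul p₁ sourceDenomSq) (coeffMul p₂ sourceSumNumerSq))
    (coeffMul p₃ (coeffAdd (coeffMul sourceSumNumer sourceSumNumer)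
      (coeffSmul (-1) sourceProdNumerSq)))

/-- Numerator of `p₀ - p₂ * v - p₃ * (u * v)`. -/
def constNumer (p₀ p₂ p₃ : List ℤ) : List ℤ :=
  coeffAdd (coeffMul p₀ sourceDenomSq)
    (coeffSmul (-1) (coeffAdd (coeffMul p₂ sourceProdNumerSq)
      (coeffMul p₃ (coeffMul sourceSumNumer sourceProdNumer))))

theorem eliminant_ne_nil : ∃ a l, eliminant = a :: l ∧ a ≠ 0 :=
  ⟨_, _, rfl, by norm_num⟩

theorem ne_zero_of_eliminant {x : ℂ} (h : hornerEval eliminant x = 0) : x ≠ 0 := by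
  rintro rfl
  obtain ⟨a, l, h1, h2⟩ := eliminant_ne_nil
  rw [h1] at h
  simp [hornerEval, h2] at h

theorem hornerEval_eq_zero_of_eliminant {x : ℂ} (h : hornerEval eliminant x = 0) (n : ℕ)
    (q : List ℤ) (hq : vanishesModulo eliminant n q = true) : hornerEval q x = 0 := by
  have hx := ne_zero_of_eliminant h
  obtain ⟨a, l, h1, h2⟩ := eliminant_ne_nil
  rw [h1] at h hq
  exact hornerEval_eq_zero_of_vanishesModulo h2 hx h n q hq

theorem eliminantDeriv_ne_zero {x : ℂ} (h : hornerEval eliminant x = 0) :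
    hornerEval eliminantDeriv x ≠ 0 :=
  hornerEval_ne_zero_of_coprimeTest (ne_zero_of_eliminant h) 40 eliminant eliminantDeriv
    (by decide +kernel) h

theorem sourceDenom_ne_zero : (sourceDenom : ℂ) ≠ 0 :=
  Int.cast_ne_zero.mpr (by decide +kernel)

/-- Value of `t₁ * t₂` as a function of `x = t₁ + t₂`. -/
def prodVal (x : ℂ) : ℂ :=
  hornerEval prodNumer x / (40 * hornerEval eliminantDeriv x)

/-- Value of `s₁ + s₂` as a function of `x = t₁ + t₂`. -/
def sourceSumVal (x : ℂ) : ℂ :=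
  hornerEval sourceSumNumer x / (sourceDenom * hornerEval eliminantDeriv x)

/-- Value of `s₁ * s₂` as a function of `x = t₁ + t₂`. -/
def sourceProdVal (x : ℂ) : ℂ :=
  hornerEval sourceProdNumer x / (sourceDenom * hornerEval eliminantDeriv x)

theorem hornerEval_formNumer {x : ℂ} (h : hornerEval eliminant x = 0) (k l m : ℤ) :
    hornerEval (formNumer k l m) x =
      40 * hornerEval eliminantDeriv x * (k + l * x + m * prodVal x) := by
  have h1 := eliminantDeriv_ne_zero h
  simp only [formNumer, hornerEval_coeffAdd, hornerEval_coeffSmul, hornerEval_coeffMul, hornerEval,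
    prodVal]
  push_cast
  field_simp
  ring

theorem hornerEval_linNumer {x : ℂ} (h : hornerEval eliminant x = 0) (p₁ p₂ p₃ : List ℤ) :
    hornerEval (linNumer p₁ p₂ p₃) x = (sourceDenom * hornerEval eliminantDeriv x) ^ 2 *
      (hornerEval p₁ x + hornerEval p₂ x * sourceSumVal x +
        hornerEval p₃ x * (sourceSumVal x ^ 2 - sourceProdVal x)) := by
  have h1 := eliminantDeriv_ne_zero h
  have h2 := sourceDenom_ne_zero
  simp only [linNumer, sourceProdNumerSq, sourceSumNumerSq, sourceDenomSq, hornerEval_coeffAdd,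
    hornerEval_coeffSmul, hornerEval_coeffMul, sourceSumVal, sourceProdVal]
  push_cast
  field_simp
  ring

theorem hornerEval_constNumer {x : ℂ} (h : hornerEval eliminant x = 0) (p₀ p₂ p₃ : List ℤ) :
    hornerEval (constNumer p₀ p₂ p₃) x = (sourceDenom * hornerEval eliminantDeriv x) ^ 2 *
      (hornerEval p₀ x - hornerEval p₂ x * sourceProdVal x -
        hornerEval p₃ x * (sourceSumVal x * sourceProdVal x)) := by
  have h1 := eliminantDeriv_ne_zero h
  have h2 := sourceDenom_ne_zero
  simp only [constNumer, sourceProdNumerSq, sourceDenomSq, hornerEval_coeffAdd,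
    hornerEval_coeffSmul, hornerEval_coeffMul, sourceSumVal, sourceProdVal]
  push_cast
  field_simp
  ring

theorem isSecant_of_eliminant {x : ℂ} (h : hornerEval eliminant x = 0) :
    IsSecant x (prodVal x) (sourceSumVal x) (sourceProdVal x) := by
  have h1 := eliminantDeriv_ne_zero h
  have h2 := sourceDenom_ne_zero
  have h3 := hornerEval_eq_zero_of_eliminant h 40 (linNumer (formNumer 34185 (-15909) 0)
    (formNumer 141275 (-27170) 0) (formNumer 68633 (-78740) 0)) (by decide +kernel)
  have h4 := hornerEval_eq_zero_of_eliminant h 40 (constNumer (formNumer (-10519) (-16872) 10000)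
    (formNumer 141275 (-27170) 0) (formNumer 68633 (-78740) 0)) (by decide +kernel)
  have h5 := hornerEval_eq_zero_of_eliminant h 40 (linNumer (formNumer 13832 (-34185) 15909)
    (formNumer 42118 (-141275) 27170) (formNumer 68602 (-68633) 78740)) (by decide +kernel)
  have h6 := hornerEval_eq_zero_of_eliminant h 40 (constNumer (formNumer 27208 10519 16872)
    (formNumer 42118 (-141275) 27170) (formNumer 68602 (-68633) 78740)) (by decide +kernel)
  simp only [hornerEval_linNumer h, hornerEval_constNumer h, hornerEval_formNumer h] at h3 h4 h5 h6
  have h7 : (sourceDenom * hornerEval eliminantDeriv x : ℂ) ^ 2 ≠ 0 :=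
    pow_ne_zero _ (mul_ne_zero h2 h1)
  have h8 : (40 * hornerEval eliminantDeriv x : ℂ) ≠ 0 := mul_ne_zero (by norm_num) h1
  replace h3 := (mul_eq_zero.mp h3).resolve_left h7
  replace h4 := (mul_eq_zero.mp h4).resolve_left h7
  replace h5 := (mul_eq_zero.mp h5).resolve_left h7
  replace h6 := (mul_eq_zero.mp h6).resolve_left h7
  push_cast at h3 h4 h5 h6
  constructor <;> apply (mul_right_inj' h8).mp
  · linear_combination h3
  · linear_combination h4
  · linear_combination h5
  · linear_combination h6

theorem prodVal_discrim {x : ℂ} (h : hornerEval eliminant x = 0) : x ^ 2 ≠ 4 * prodVal x := by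
  have h1 := eliminantDeriv_ne_zero h
  have h2 := hornerEval_ne_zero_of_coprimeTest (ne_zero_of_eliminant h) 40
    (coeffAdd (coeffMul [0, 0, 10] eliminantDeriv) (coeffSmul (-1) prodNumer)) eliminant
    (by decide +kernel)
  intro h3
  refine h2 ?_ h
  rw [prodVal] at h3
  simp only [hornerEval_coeffAdd, hornerEval_coeffSmul, hornerEval_coeffMul, hornerEval]
  push_cast
  field_simp at h3
  linear_combination (1 / 4 : ℂ) * h3

theorem sourceProdVal_discrim {x : ℂ} (h : hornerEval eliminant x = 0) :
    sourceSumVal x ^ 2 ≠ 4 * sourceProdVal x := by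
  have h1 := eliminantDeriv_ne_zero h
  have h2 := sourceDenom_ne_zero
  have h3 := hornerEval_ne_zero_of_coprimeTest (ne_zero_of_eliminant h) 60
    (coeffAdd (coeffMul sourceSumNumer sourceSumNumer) (coeffSmul (-4) sourceProdNumerSq))
    eliminant (by decide +kernel)
  intro h4
  refine h3 ?_ h
  rw [sourceSumVal, sourceProdVal] at h4
  simp only [hornerEval_coeffAdd, hornerEval_coeffSmul, hornerEval_coeffMul, sourceProdNumerSq]
  push_cast
  field_simp at h4
  linear_combination h4

theorem eliminant_ne_zero_of_real (x : ℝ) : hornerEval eliminant x ≠ 0 := by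
  rcases lt_or_ge x (-132 / 100) with h1 | h1
  · refine hornerEval_ne_zero_of_coeffMobius (-1) (-132) 0 100 eliminant (by decide +kernel) ?_ ?_ ?_
    all_goals norm_num
    all_goals linarith
  rcases lt_or_ge x (-1308 / 1000) with h2 | h2
  · refine hornerEval_ne_zero_of_coeffMobius (-1320) (-1308) 1000 1000 eliminant
      (by decide +kernel) ?_ ?_ ?_
    all_goals norm_num
    all_goals linarith
  rcases lt_or_ge x (-3 / 10) with h3 | h3
  · refine hornerEval_ne_zero_of_coeffMobius (-1308) (-3) 1000 10 eliminant
      (by decide +kernel) ?_ ?_ ?_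
    all_goals norm_num
    all_goals linarith
  rcases lt_or_ge x 1 with h4 | h4
  · refine hornerEval_ne_zero_of_coeffMobius (-3) 1 10 1 eliminant (by decide +kernel) ?_ ?_ ?_
    all_goals norm_num
    all_goals linarith
  · refine hornerEval_ne_zero_of_coeffMobius 1 1 1 0 eliminant (by decide +kernel) ?_ ?_ ?_
    all_goals norm_num
    all_goals linarith

section Bezout

variable {R : Type*} [CommRing R] {p₀ p₁ p₂ p₃ q₀ q₁ q₂ q₃ u v : R}

/-- Minors of order two of the Bézout matrix of two cubics with the given coefficients. -/
def bezoutMinor (p₀ p₁ p₂ p₃ q₀ q₁ q₂ q₃ : R) : Fin 5 → R :=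
  let b₀₁ := p₀ * q₁ - p₁ * q₀
  let b₀₂ := p₀ * q₂ - p₂ * q₀
  let b₀₃ := p₀ * q₃ - p₃ * q₀
  let b₁₂ := p₁ * q₂ - p₂ * q₁
  let b₁₃ := p₁ * q₃ - p₃ * q₁
  let b₂₃ := p₂ * q₃ - p₃ * q₂
  ![b₀₁ * (b₀₃ + b₁₂) - b₀₂ ^ 2, b₀₁ * b₁₃ - b₀₂ * b₀₃, b₀₁ * b₂₃ - b₀₃ ^ 2,
    b₀₂ * b₂₃ - b₀₃ * b₁₃, (b₀₃ + b₁₂) * b₂₃ - b₁₃ ^ 2]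

/-- The Bézout matrix of two cubics with a common quadratic factor `s ^ 2 - u * s + v` has rank at
most one. -/
theorem bezoutMinor_eq_zero (hp₁ : p₁ + p₂ * u + p₃ * (u ^ 2 - v) = 0)
    (hp₀ : p₀ - p₂ * v - p₃ * (u * v) = 0) (hq₁ : q₁ + q₂ * u + q₃ * (u ^ 2 - v) = 0)
    (hq₀ : q₀ - q₂ * v - q₃ * (u * v) = 0) (i : Fin 5) :
    bezoutMinor p₀ p₁ p₂ p₃ q₀ q₁ q₂ q₃ i = 0 := by
  obtain rfl : p₁ = -(p₂ * u + p₃ * (u ^ 2 - v)) := by linear_combination hp₁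
  obtain rfl : p₀ = p₂ * v + p₃ * (u * v) := by linear_combination hp₀
  obtain rfl : q₁ = -(q₂ * u + q₃ * (u ^ 2 - v)) := by linear_combination hq₁
  obtain rfl : q₀ = q₂ * v + q₃ * (u * v) := by linear_combination hq₀
  fin_cases i <;> simp only [bezoutMinor] <;> simp <;> ring

end Bezout

theorem eliminant_identity (x e : ℂ) :
    ∑ i, hornerEval (eliminantCofactor i) x * bezoutMinor
      (-10519 - 16872 * x + 10000 * e) (34185 - 15909 * x) (141275 - 27170 * x) (68633 - 78740 * x)
      (27208 + 10519 * x + 16872 * e) (13832 - 34185 * x + 15909 * e)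
      (42118 - 141275 * x + 27170 * e) (68602 - 68633 * x + 78740 * e) i =
    20 * hornerEval eliminant x := by
  simp only [Fin.sum_univ_five, eliminantCofactor, bezoutMinor, eliminant, hornerEval,
    Matrix.cons_val]
  push_cast
  ring

theorem prodNumer_identity (x e : ℂ) :
    ∑ i, hornerEval (prodCofactor i) x * bezoutMinor
      (-10519 - 16872 * x + 10000 * e) (34185 - 15909 * x) (141275 - 27170 * x) (68633 - 78740 * x)
      (27208 + 10519 * x + 16872 * e) (13832 - 34185 * x + 15909 * e)
      (42118 - 141275 * x + 27170 * e) (68602 - 68633 * x + 78740 * e) i =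
    800 * hornerEval eliminantDeriv x * e - 20 * hornerEval prodNumer x := by
  simp only [Fin.sum_univ_five, prodCofactor, bezoutMinor, eliminant, eliminantDeriv, coeffDeriv,
    coeffAdd, prodNumer, hornerEval, Matrix.cons_val]
  push_cast
  ring

theorem eliminant_eq_zero {x e u v : ℂ} (h : IsSecant x e u v) : hornerEval eliminant x = 0 := by
  have h1 := eliminant_identity x e
  simp only [bezoutMinor_eq_zero h.lin₁ h.const₁ h.lin₂ h.const₂, mul_zero,
    Finset.sum_const_zero] at h1
  exact (mul_eq_zero.mp h1.symm).resolve_left (by norm_num)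

theorem eq_prodVal {x e u v : ℂ} (h : IsSecant x e u v) : e = prodVal x := by
  have h1 := prodNumer_identity x e
  simp only [bezoutMinor_eq_zero h.lin₁ h.const₁ h.lin₂ h.const₂, mul_zero,
    Finset.sum_const_zero] at h1
  have h2 := eliminantDeriv_ne_zero (eliminant_eq_zero h)
  rw [prodVal, eq_div_iff (mul_ne_zero (by norm_num) h2)]
  linear_combination (-1 / 20 : ℂ) * h1

theorem cross_ne_zero {x e u v : ℂ} (h : IsSecant x e u v) :
    (141275 - 27170 * x) * (68602 - 68633 * x + 78740 * e) -
      (68633 - 78740 * x) * (42118 - 141275 * x + 27170 * e) ≠ 0 := by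
  intro h0
  have h1 := h.lin₁
  have h2 := h.lin₂
  have h31 : (68633 - 78740 * x) * (13832 - 34185 * x + 15909 * e) -
      (34185 - 15909 * x) * (68602 - 68633 * x + 78740 * e) = 0 := by
    linear_combination (68633 - 78740 * x) * h2 - (68602 - 68633 * x + 78740 * e) * h1 + u * h0
  have h12 : (34185 - 15909 * x) * (42118 - 141275 * x + 27170 * e) -
      (141275 - 27170 * x) * (13832 - 34185 * x + 15909 * e) = 0 := by
    linear_combination (42118 - 141275 * x + 27170 * e) * h1 - (141275 - 27170 * x) * h2 +
      (u ^ 2 - v) * h0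
  have h3 : (29776545468924 : ℂ) = 0 := by
    linear_combination 15909 * h0 + 27170 * h31 + 78740 * h12
  norm_num at h3

theorem isSecant_iff {x e u v : ℂ} :
    IsSecant x e u v ↔ hornerEval eliminant x = 0 ∧ e = prodVal x ∧ u = sourceSumVal x ∧
      v = sourceProdVal x := by
  constructor
  · intro h
    have hx := eliminant_eq_zero h
    obtain rfl := eq_prodVal h
    have h' := isSecant_of_eliminant hx
    have hc := cross_ne_zero h
    have hu : u = sourceSumVal x := by
      apply mul_left_cancel₀ hc
      linear_combination (68602 - 68633 * x + 78740 * prodVal x) * (h.lin₁ - h'.lin₁) -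
        (68633 - 78740 * x) * (h.lin₂ - h'.lin₂)
    have hw : u ^ 2 - v = sourceSumVal x ^ 2 - sourceProdVal x := by
      apply mul_left_cancel₀ hc
      linear_combination (141275 - 27170 * x) * (h.lin₂ - h'.lin₂) -
        (42118 - 141275 * x + 27170 * prodVal x) * (h.lin₁ - h'.lin₁)
    exact ⟨hx, rfl, hu, by rw [hu] at hw; linear_combination -hw⟩
  · rintro ⟨hx, rfl, rfl, rfl⟩
    exact isSecant_of_eliminant hx

/-! ### From the symmetric functions to the solutions -/

theorem exists_add_eq_mul_eq (p q : ℂ) : ∃ y : ℂ × ℂ, y.1 + y.2 = p ∧ y.1 * y.2 = q := by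
  obtain ⟨r, hr⟩ := IsAlgClosed.exists_pow_nat_eq (p ^ 2 - 4 * q) (n := 2) (by norm_num)
  refine ⟨((p + r) / 2, (p - r) / 2), ?_, ?_⟩
  · simp only
    ring
  · simp only
    linear_combination (-1 / 4 : ℂ) * hr

theorem cubic_pair_iff {c₀ c₁ c₂ c₃ s₁ s₂ : ℂ} (hs : s₁ ≠ s₂) :
    (c₀ + c₁ * s₁ + c₂ * s₁ ^ 2 + c₃ * s₁ ^ 3 = 0 ∧ c₀ + c₁ * s₂ + c₂ * s₂ ^ 2 + c₃ * s₂ ^ 3 = 0) ↔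
      (c₁ + c₂ * (s₁ + s₂) + c₃ * ((s₁ + s₂) ^ 2 - s₁ * s₂) = 0 ∧
        c₀ - c₂ * (s₁ * s₂) - c₃ * ((s₁ + s₂) * (s₁ * s₂)) = 0) := by
  constructor
  · rintro ⟨h1, h2⟩
    have h3 : c₁ + c₂ * (s₁ + s₂) + c₃ * ((s₁ + s₂) ^ 2 - s₁ * s₂) = 0 := by
      apply mul_left_cancel₀ (sub_ne_zero.mpr hs)
      linear_combination h1 - h2
    exact ⟨h3, by linear_combination h1 - s₁ * h3⟩
  · rintro ⟨h1, h2⟩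
    exact ⟨by linear_combination h2 + s₁ * h1, by linear_combination h2 + s₂ * h1⟩

theorem f₁_M₁₇ (t₁ t₂ s : ℂ) :
    10000 * f₁ (M₁₇.map (fun q => (q : ℂ))) t₁ t₂ s =
      (-10519 - 16872 * (t₁ + t₂) + 10000 * (t₁ * t₂)) + (34185 - 15909 * (t₁ + t₂)) * s +
        (141275 - 27170 * (t₁ + t₂)) * s ^ 2 + (68633 - 78740 * (t₁ + t₂)) * s ^ 3 := by
  simp [f₁, pc, tcv, M₁₇, Matrix.mulVec, dotProduct, Fin.sum_univ_four]
  ring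

theorem f₂_M₁₇ (t₁ t₂ s : ℂ) :
    10000 * f₂ (M₁₇.map (fun q => (q : ℂ))) t₁ t₂ s =
      (27208 + 10519 * (t₁ + t₂) + 16872 * (t₁ * t₂)) +
        (13832 - 34185 * (t₁ + t₂) + 15909 * (t₁ * t₂)) * s +
        (42118 - 141275 * (t₁ + t₂) + 27170 * (t₁ * t₂)) * s ^ 2 +
        (68602 - 68633 * (t₁ + t₂) + 78740 * (t₁ * t₂)) * s ^ 3 := by
  simp [f₂, pc, tcv, M₁₇, Matrix.mulVec, dotProduct, Fin.sum_univ_four]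
  ring

theorem mem_Ssol_iff (x : Fin 4 → ℂ) :
    x ∈ Ssol (M₁₇.map (fun q => (q : ℂ))) ↔ x 0 ≠ x 1 ∧ x 2 ≠ x 3 ∧
      IsSecant (x 0 + x 1) (x 0 * x 1) (x 2 + x 3) (x 2 * x 3) := by
  have h0 : ∀ z : ℂ, z = 0 ↔ 10000 * z = 0 := fun z => by simp
  have hF : Fmap (M₁₇.map (fun q => (q : ℂ))) x = 0 ↔
      (f₁ (M₁₇.map (fun q => (q : ℂ))) (x 0) (x 1) (x 2) = 0 ∧
        f₁ (M₁₇.map (fun q => (q : ℂ))) (x 0) (x 1) (x 3) = 0) ∧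
      (f₂ (M₁₇.map (fun q => (q : ℂ))) (x 0) (x 1) (x 2) = 0 ∧
        f₂ (M₁₇.map (fun q => (q : ℂ))) (x 0) (x 1) (x 3) = 0) := by
    rw [funext_iff, Fin.forall_fin_succ, Fin.forall_fin_succ, Fin.forall_fin_two]
    simp [Fmap, and_assoc]
  rw [Ssol, Set.mem_ofPred_eq, hF, and_comm, and_assoc]
  refine and_congr_right fun _ => and_congr_right fun hs => ?_
  rw [h0 (f₁ _ _ _ (x 2)), h0 (f₁ _ _ _ (x 3)), h0 (f₂ _ _ _ (x 2)), h0 (f₂ _ _ _ (x 3)),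
    f₁_M₁₇, f₁_M₁₇, f₂_M₁₇, f₂_M₁₇, cubic_pair_iff hs, cubic_pair_iff hs]
  exact ⟨fun ⟨⟨h1, h2⟩, h3, h4⟩ => ⟨h1, h2, h3, h4⟩, fun ⟨h1, h2, h3, h4⟩ => ⟨⟨h1, h2⟩, h3, h4⟩⟩

theorem pair_eq_or_swap {y z : ℂ × ℂ} (h₁ : y.1 + y.2 = z.1 + z.2) (h₂ : y.1 * y.2 = z.1 * z.2) :
    y = z ∨ y = z.swap := by
  have h : (y.1 - z.1) * (y.1 - z.2) = 0 := by linear_combination y.1 * h₁ - h₂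
  rcases mul_eq_zero.mp h with h | h
  · exact Or.inl (Prod.ext (sub_eq_zero.mp h) (by linear_combination h₁ - h))
  · exact Or.inr (Prod.ext (sub_eq_zero.mp h) (by
      simp only [Prod.snd_swap]
      linear_combination h₁ - h))

theorem ne_of_discrim {y : ℂ × ℂ} {p q : ℂ} (h₁ : y.1 + y.2 = p) (h₂ : y.1 * y.2 = q)
    (h : p ^ 2 ≠ 4 * q) : y.1 ≠ y.2 := by
  intro h3
  apply h
  rw [← h₁, ← h₂, h3]
  ring

/-- The pair `y`, swapped when `b` is true. -/
def swapIf (b : Bool) (y : ℂ × ℂ) : ℂ × ℂ :=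
  if b then y.swap else y

theorem swapIf_add (b : Bool) (y : ℂ × ℂ) : (swapIf b y).1 + (swapIf b y).2 = y.1 + y.2 := by
  cases b <;> simp [swapIf, add_comm]

theorem swapIf_mul (b : Bool) (y : ℂ × ℂ) : (swapIf b y).1 * (swapIf b y).2 = y.1 * y.2 := by
  cases b <;> simp [swapIf, mul_comm]

theorem swapIf_injective {y : ℂ × ℂ} (hy : y.1 ≠ y.2) {b c : Bool} (h : swapIf b y = swapIf c y) :
    b = c := by
  cases b <;> cases c <;> simp [swapIf, Prod.ext_iff, hy, hy.symm] at h ⊢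

theorem exists_swapIf {y z : ℂ × ℂ} (h₁ : y.1 + y.2 = z.1 + z.2) (h₂ : y.1 * y.2 = z.1 * z.2) :
    ∃ b, y = swapIf b z := by
  rcases pair_eq_or_swap h₁ h₂ with h | h
  · exact ⟨false, by simpa [swapIf] using h⟩
  · exact ⟨true, by simpa [swapIf] using h⟩

/-- The solutions above a zero of the eliminant, given the parameters of a pair of points on each of
the two cubics. -/
def solutionOf (t s : ℂ → ℂ × ℂ) (p : ℂ × Bool × Bool) : Fin 4 → ℂ :=
  ![(swapIf p.2.1 (t p.1)).1, (swapIf p.2.1 (t p.1)).2,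
    (swapIf p.2.2 (s p.1)).1, (swapIf p.2.2 (s p.1)).2]

theorem mem_roots_eliminant {x : ℂ} :
    x ∈ (ofCoeffs eliminant).roots.toFinset ↔ hornerEval eliminant x = 0 := by
  have h : ofCoeffs eliminant ≠ 0 := by
    intro h
    have h1 := eval_ofCoeffs eliminant 0
    rw [h, Polynomial.eval_zero] at h1
    exact ne_zero_of_eliminant h1.symm rfl
  rw [Multiset.mem_toFinset, Polynomial.mem_roots h, Polynomial.IsRoot, eval_ofCoeffs]

theorem card_roots_eliminant : (ofCoeffs eliminant).roots.toFinset.card = 10 :=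
  card_roots_ofCoeffs (by decide +kernel) (by decide +kernel) fun _ => eliminantDeriv_ne_zero

theorem ncard_Ssol : (Ssol (M₁₇.map (fun q => (q : ℂ)))).ncard = 40 := by
  choose t ht₁ ht₂ using fun x => exists_add_eq_mul_eq x (prodVal x)
  choose s hs₁ hs₂ using fun x => exists_add_eq_mul_eq (sourceSumVal x) (sourceProdVal x)
  have hS : Ssol (M₁₇.map (fun q => (q : ℂ))) = solutionOf t s ''
      ((ofCoeffs eliminant).roots.toFinset ×ˢ (Finset.univ : Finset (Bool × Bool)) :
        Finset (ℂ × Bool × Bool)) := by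
    ext x
    simp only [mem_Ssol_iff, isSecant_iff, Set.mem_image, Finset.mem_coe, Finset.mem_product,
      mem_roots_eliminant, Finset.mem_univ, and_true, Prod.exists]
    constructor
    · rintro ⟨-, -, hx, he, hu, hv⟩
      obtain ⟨b, hb⟩ := exists_swapIf (y := (x 0, x 1)) (ht₁ (x 0 + x 1)).symm
        (he.trans (ht₂ (x 0 + x 1)).symm)
      obtain ⟨c, hc⟩ := exists_swapIf (y := (x 2, x 3)) (hu.trans (hs₁ (x 0 + x 1)).symm)
        (hv.trans (hs₂ (x 0 + x 1)).symm)
      refine ⟨x 0 + x 1, b, c, hx, ?_⟩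
      rw [solutionOf, ← hb, ← hc]
      ext i
      fin_cases i <;> rfl
    · rintro ⟨z, b, c, hz, rfl⟩
      simp only [solutionOf, Matrix.cons_val]
      have h1 := (swapIf_add b (t z)).trans (ht₁ z)
      have h2 := (swapIf_mul b (t z)).trans (ht₂ z)
      have h3 := (swapIf_add c (s z)).trans (hs₁ z)
      have h4 := (swapIf_mul c (s z)).trans (hs₂ z)
      refine ⟨ne_of_discrim h1 h2 (prodVal_discrim hz),
        ne_of_discrim h3 h4 (sourceProdVal_discrim hz), ?_⟩
      rw [h1, h2, h3, h4]
      exact ⟨hz, rfl, rfl, rfl⟩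
  have hinj : Set.InjOn (solutionOf t s)
      ((ofCoeffs eliminant).roots.toFinset ×ˢ (Finset.univ : Finset (Bool × Bool)) :
        Finset (ℂ × Bool × Bool)) := by
    rintro ⟨z, b, c⟩ hz ⟨z', b', c'⟩ - h
    simp only [Finset.mem_coe, Finset.mem_product, mem_roots_eliminant, Finset.mem_univ,
      and_true] at hz
    have h0 : swapIf b (t z) = swapIf b' (t z') := Prod.ext (congrFun h 0) (congrFun h 1)
    have h1 : swapIf c (s z) = swapIf c' (s z') := Prod.ext (congrFun h 2) (congrFun h 3)
    obtain rfl : z = z' := by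
      rw [← ht₁ z, ← ht₁ z', ← swapIf_add b (t z), h0, swapIf_add]
    rw [swapIf_injective (ne_of_discrim (ht₁ z) (ht₂ z) (prodVal_discrim hz)) h0,
      swapIf_injective (ne_of_discrim (hs₁ z) (hs₂ z) (sourceProdVal_discrim hz)) h1]
  rw [hS, hinj.ncard_image, Set.ncard_coe_finset, Finset.card_product,
    card_roots_eliminant]
  rfl

theorem add_ne_conj_add {x : Fin 4 → ℂ} (hx : x ∈ Ssol (M₁₇.map (fun q => (q : ℂ)))) :
    (starRingEnd ℂ) (x 0 + x 1) ≠ x 0 + x 1 := by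
  intro h
  obtain ⟨r, hr⟩ := Complex.conj_eq_iff_real.mp h
  have h1 := eliminant_eq_zero ((mem_Ssol_iff x).mp hx).2.2
  rw [hr] at h1
  have h2 := map_hornerEval Complex.ofRealHom eliminant r
  exact eliminant_ne_zero_of_real r (Complex.ofReal_eq_zero.mp (h2.trans h1))

/-- For this matrix, `S(M)` has exactly 40 elements, and no element satisfies
`{t₁, t₂} = {conj t₁, conj t₂}`; i.e., none of the ten common secant lines of the
standard twisted cubic and its image under `M` is real. -/
theorem no_real_lines :
    (Ssol (M₁₇.map (fun q => (q : ℂ)))).ncard = 40 ∧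
    ∀ x ∈ Ssol (M₁₇.map (fun q => (q : ℂ))),
      ({x 0, x 1} : Set ℂ) ≠ {(starRingEnd ℂ) (x 0), (starRingEnd ℂ) (x 1)} := by
  refine ⟨ncard_Ssol, fun x hx h => add_ne_conj_add hx ?_⟩
  rcases Set.pair_eq_pair_iff.mp h with ⟨h1, h2⟩ | ⟨h1, h2⟩
  · rw [map_add, ← h1, ← h2]
  · rw [map_add, ← h1, ← h2, add_comm]
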